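/- arXiv:2504.18262 — 2 statements merged into one kernel-verified Lean document; each statement's English description precedes it below -/
import Mathlib

section
/- Let (Ω, P) be a probability space, X : Ω → ℝ^p a measurable random vector, and A : Ω → {0,1} a measurable random variable. Let T be a binary decision tree over ℝ^p with measurable test sets and leaf labels in {−1,1}. If for every terminal node (leaf) t of T the random variable A is independent of the indicator of the event {ω : X(ω) ∈ dom(T_t)} (i.e., every terminal branch satisfies Local Statistical Parity with respect to A), then the random variable T(X) is independent of A. (Lemma 1 / Lemma 5 of the paper.) -/
/-- A binary decision tree over ℝ^p: either a leaf with a real label,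
or a decision node with a test set and two subtrees. -/
inductive DTree (p : ℕ) : Type where
  | leaf (label : ℝ) : DTree p
  | node (S : Set (Fin p → ℝ)) (L R : DTree p) : DTree p

namespace DTree

variable {p : ℕ}

open Classical

/-- Evaluation of a decision tree: at a decision node with test set `S`,
go left if `x ∈ S`, else right; at a leaf return its label. -/
noncomputable def eval : DTree p → (Fin p → ℝ) → ℝ
  | leaf y, _ => y
  | node S L R, x => if x ∈ S then L.eval x else R.eval x

/-- The list of (label, domain) pairs of the terminal nodes (leaves) of a tree,
where `D` is the domain of the root. -/
def leaves : DTree p → Set (Fin p → ℝ) → List (ℝ × Set (Fin p → ℝ))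
  | leaf y, D => [(y, D)]
  | node S L R, D => L.leaves (D ∩ S) ++ R.leaves (D ∩ Sᶜ)

/-- The list of (domain, test set) pairs of the decision nodes of a tree,
where `D` is the domain of the root. -/
def decisions : DTree p → Set (Fin p → ℝ) → List (Set (Fin p → ℝ) × Set (Fin p → ℝ))
  | leaf _, _ => []
  | node S L R, D => (D, S) :: (L.decisions (D ∩ S) ++ R.decisions (D ∩ Sᶜ))

/-- The list of the domains of all nodes (decision and terminal) of a tree,
where `D` is the domain of the root. -/
def nodeDoms : DTree p → Set (Fin p → ℝ) → List (Set (Fin p → ℝ))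
  | leaf _, D => [D]
  | node S L R, D => D :: (L.nodeDoms (D ∩ S) ++ R.nodeDoms (D ∩ Sᶜ))

/-- All test sets of the tree are measurable. -/
def MeasurableTests : DTree p → Prop
  | leaf _ => True
  | node S L R => MeasurableSet S ∧ L.MeasurableTests ∧ R.MeasurableTests

/-- All leaf labels lie in {-1, 1}. -/
def LabelsPM : DTree p → Prop
  | leaf y => y = -1 ∨ y = 1
  | node _ L R => L.LabelsPM ∧ R.LabelsPM

end DTree

open MeasureTheory ProbabilityTheory

/-- If every leaf domain is independent of the event `E`, then so is, within the domain `D` of the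
root, every event expressed through the value of the tree. -/
theorem DTree.measure_eval_inter_eq_mul {Ω : Type*} [MeasurableSpace Ω] {P : Measure Ω}
    {p : ℕ} {X : Ω → (Fin p → ℝ)} (hX : Measurable X) (E : Set Ω) (B : Set ℝ)
    (T : DTree p) (hT : T.MeasurableTests) (D : Set (Fin p → ℝ))
    (h : ∀ ld ∈ T.leaves D, P ({ω | X ω ∈ ld.2} ∩ E) = P {ω | X ω ∈ ld.2} * P E) :
    P ({ω | X ω ∈ D ∧ T.eval (X ω) ∈ B} ∩ E) = P {ω | X ω ∈ D ∧ T.eval (X ω) ∈ B} * P E := by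
  induction T generalizing D with
  | leaf y =>
    by_cases hy : y ∈ B
    · simpa [DTree.eval, hy] using h (y, D) (by simp [DTree.leaves])
    · simp [DTree.eval, hy]
  | node S L R ihL ihR =>
    obtain ⟨hS, hL, hR⟩ := hT
    have hl := ihL hL (D ∩ S) fun ld hld => h ld (by simp [DTree.leaves, hld])
    have hr := ihR hR (D ∩ Sᶜ) fun ld hld => h ld (by simp [DTree.leaves, hld])
    set F := {ω | X ω ∈ D ∧ (DTree.node S L R).eval (X ω) ∈ B} with hF
    have hFl : {ω | X ω ∈ D ∩ S ∧ L.eval (X ω) ∈ B} = F ∩ X ⁻¹' S := by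
      ext ω
      by_cases hω : X ω ∈ S <;> simp [hF, DTree.eval, hω]
    have hFr : {ω | X ω ∈ D ∩ Sᶜ ∧ R.eval (X ω) ∈ B} = F \ X ⁻¹' S := by
      ext ω
      by_cases hω : X ω ∈ S <;> simp [hF, DTree.eval, hω]
    rw [hFl] at hl
    rw [hFr] at hr
    rw [← measure_inter_add_sdiff (F ∩ E) (hX hS), ← measure_inter_add_sdiff F (hX hS), add_mul,
      ← hl, ← hr, Set.inter_right_comm, Set.inter_sdiff_right_comm]

/-- A preimage under a function with values in `{0, 1}` is trivial or one of the two fibres. -/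
theorem preimage_eq_of_forall_eq_zero_or_one {Ω : Type*} {A : Ω → ℝ}
    (hA : ∀ ω, A ω = 0 ∨ A ω = 1) (u : Set ℝ) :
    A ⁻¹' u = ∅ ∨ A ⁻¹' u = Set.univ ∨ ∃ a ∈ ({0, 1} : Set ℝ), A ⁻¹' u = {ω | A ω = a} := by
  by_cases h0 : (0 : ℝ) ∈ u <;> by_cases h1 : (1 : ℝ) ∈ u
  · refine Or.inr (Or.inl ?_)
    ext ω
    rcases hA ω with h | h <;> simp [h, h0, h1]
  · refine Or.inr (Or.inr ⟨0, by simp, ?_⟩)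
    ext ω
    rcases hA ω with h | h <;> simp [h, h0, h1]
  · refine Or.inr (Or.inr ⟨1, by simp, ?_⟩)
    ext ω
    rcases hA ω with h | h <;> simp [h, h0, h1]
  · refine Or.inl ?_
    ext ω
    rcases hA ω with h | h <;> simp [h, h0, h1]

/-- **Lemma 1 (Local Statistical Parity at all leaves implies Statistical Parity).**
If for every terminal node `t` of `T` the random variable `A` is independent of the
indicator of the event `{X ∈ dom(T_t)}`, then `T(X)` is independent of `A`. -/
theorem lemma_local_parity_implies_global_parity
    {Ω : Type*} [MeasurableSpace Ω] (P : Measure Ω) [IsProbabilityMeasure P]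
    {p : ℕ} (X : Ω → (Fin p → ℝ)) (hX : Measurable X)
    (A : Ω → ℝ) (hA : Measurable A) (hAval : ∀ ω, A ω = 0 ∨ A ω = 1)
    (T : DTree p) (hTmeas : T.MeasurableTests) (hTlab : T.LabelsPM)
    (hLocal : ∀ ld ∈ T.leaves Set.univ, ∀ a ∈ ({0, 1} : Set ℝ),
      P ({ω | X ω ∈ ld.2} ∩ {ω | A ω = a})
        = P {ω | X ω ∈ ld.2} * P {ω | A ω = a}) :
    IndepFun (fun ω => T.eval (X ω)) A P := by
  rw [indepFun_iff_measure_inter_preimage_eq_mul]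
  intro B u _ _
  have key := T.measure_eval_inter_eq_mul (P := P) hX (A ⁻¹' u) B hTmeas Set.univ fun ld hld => by
    rcases preimage_eq_of_forall_eq_zero_or_one hAval u with h | h | ⟨a, ha, h⟩
    · simp [h]
    · simp [h]
    · rw [h]
      exact hLocal ld hld a ha
  simpa [Set.preimage] using key
end

section
/- Let (Ω, P) be a probability space, X : Ω → ℝ^p a measurable random vector, and A : Ω → {0,1} a measurable random variable. Let T be a binary decision tree over ℝ^p with measurable test sets. Fix α ∈ ℝ \ {0,1}. If for every decision node t of T the conditional independence of A and I*_t(X) given the event {X ∈ dom(T_t)} holds in product form (for all a ∈ {0,1}, i ∈ {0,1}: P({I*_t(X)=i} ∩ {A=a} ∩ {X ∈ dom(T_t)}) · P(X ∈ dom(T_t)) = P({I*_t(X)=i} ∩ {X ∈ dom(T_t)}) · P({A=a} ∩ {X ∈ dom(T_t)})), then every node t of T (decision and terminal) satisfies Local Statistical Parity, i.e., A is independent of the indicator of the event {X ∈ dom(T_t)}. (Lemma 2 / Lemma 7 of the paper.) -/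
open MeasureTheory ProbabilityTheory Classical in
/-- The extended test `I*_t` of a decision node with domain `D` and test set `S`:
it takes the value `α` outside `D` and the indicator of `S` on `D`. -/
noncomputable def extTest {p : ℕ} (α : ℝ) (D S : Set (Fin p → ℝ)) (x : Fin p → ℝ) : ℝ :=
  if x ∈ D then (if x ∈ S then 1 else 0) else α

open MeasureTheory ProbabilityTheory

/-- If `B` has the product property with `F`, and `E`, `B` are conditionally independent given `F`
in product form, then `B` has the product property with `E ∩ F`. -/
theorem measure_inter_eq_mul_of_cond {Ω : Type*} [MeasurableSpace Ω] (P : Measure Ω)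
    [IsFiniteMeasure P] {E F B : Set Ω} (hF : P (F ∩ B) = P F * P B)
    (h : P (E ∩ B ∩ F) * P F = P (E ∩ F) * P (B ∩ F)) :
    P (E ∩ F ∩ B) = P (E ∩ F) * P B := by
  by_cases h0 : P F = 0
  · rw [measure_mono_null (Set.inter_subset_left.trans Set.inter_subset_right) h0,
      measure_mono_null Set.inter_subset_right h0, zero_mul]
  · rw [Set.inter_comm B F, hF, Set.inter_right_comm] at h
    rw [← ENNReal.mul_left_inj h0 (measure_ne_top P F), h]
    ring

theorem inter_extTest_eq_one {p : ℕ} {α : ℝ} {Ω : Type*} (X : Ω → (Fin p → ℝ))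
    (D S : Set (Fin p → ℝ)) :
    {ω | extTest α D S (X ω) = 1} ∩ {ω | X ω ∈ D} = {ω | X ω ∈ D ∩ S} := by
  ext ω
  by_cases hD : X ω ∈ D <;> by_cases hS : X ω ∈ S <;> simp [extTest, hD, hS]

theorem inter_extTest_eq_zero {p : ℕ} {α : ℝ} {Ω : Type*} (X : Ω → (Fin p → ℝ))
    (D S : Set (Fin p → ℝ)) :
    {ω | extTest α D S (X ω) = 0} ∩ {ω | X ω ∈ D} = {ω | X ω ∈ D ∩ Sᶜ} := by
  ext ω
  by_cases hD : X ω ∈ D <;> by_cases hS : X ω ∈ S <;> simp [extTest, hD, hS]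

/-- Product-form independence of an event `B` from the root domain propagates to the domains of
all nodes of the tree. -/
theorem DTree.measure_nodeDoms_inter {Ω : Type*} [MeasurableSpace Ω] (P : Measure Ω)
    [IsFiniteMeasure P] {p : ℕ} (X : Ω → (Fin p → ℝ)) (B : Set Ω) (α : ℝ) (T : DTree p)
    (D₀ : Set (Fin p → ℝ)) (hroot : P ({ω | X ω ∈ D₀} ∩ B) = P {ω | X ω ∈ D₀} * P B)
    (hCond : ∀ DS ∈ T.decisions D₀, ∀ i ∈ ({0, 1} : Set ℝ),
      P ({ω | extTest α DS.1 DS.2 (X ω) = i} ∩ B ∩ {ω | X ω ∈ DS.1}) * P {ω | X ω ∈ DS.1}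
        = P ({ω | extTest α DS.1 DS.2 (X ω) = i} ∩ {ω | X ω ∈ DS.1})
          * P (B ∩ {ω | X ω ∈ DS.1})) :
    ∀ D ∈ T.nodeDoms D₀, P ({ω | X ω ∈ D} ∩ B) = P {ω | X ω ∈ D} * P B := by
  induction T generalizing D₀ with
  | leaf y =>
    intro D hD
    rw [DTree.nodeDoms, List.mem_singleton] at hD
    rwa [hD]
  | node S L R ihL ihR =>
    simp only [DTree.decisions, List.forall_mem_cons, List.forall_mem_append] at hCond
    obtain ⟨hS, hL, hR⟩ := hCond
    simp only [DTree.nodeDoms, List.forall_mem_cons, List.forall_mem_append]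
    refine ⟨hroot, ihL _ ?_ hL, ihR _ ?_ hR⟩
    · rw [← inter_extTest_eq_one (α := α)]
      exact measure_inter_eq_mul_of_cond P hroot (hS 1 (by simp))
    · rw [← inter_extTest_eq_zero (α := α)]
      exact measure_inter_eq_mul_of_cond P hroot (hS 0 (by simp))

/-- **Lemma 2 (Conditional independence of all decision tests implies Local Statistical
Parity at every node).** If for every decision node `t` of `T` the conditional independence
of `A` and `I*_t(X)` given `{X ∈ dom(T_t)}` holds in product form, then every node of `T`
(decision and terminal) satisfies Local Statistical Parity with respect to `A`. -/
theorem lemma_cond_indep_tests_implies_local_parity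
    {Ω : Type*} [MeasurableSpace Ω] (P : Measure Ω) [IsProbabilityMeasure P]
    {p : ℕ} (X : Ω → (Fin p → ℝ)) (hX : Measurable X)
    (A : Ω → ℝ) (hA : Measurable A) (hAval : ∀ ω, A ω = 0 ∨ A ω = 1)
    (α : ℝ) (hα : α ∉ ({0, 1} : Set ℝ))
    (T : DTree p) (hTmeas : T.MeasurableTests)
    (hCond : ∀ DS ∈ T.decisions Set.univ, ∀ a ∈ ({0, 1} : Set ℝ), ∀ i ∈ ({0, 1} : Set ℝ),
      P ({ω | extTest α DS.1 DS.2 (X ω) = i} ∩ {ω | A ω = a} ∩ {ω | X ω ∈ DS.1})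
          * P {ω | X ω ∈ DS.1}
        = P ({ω | extTest α DS.1 DS.2 (X ω) = i} ∩ {ω | X ω ∈ DS.1})
          * P ({ω | A ω = a} ∩ {ω | X ω ∈ DS.1})) :
    ∀ D ∈ T.nodeDoms Set.univ, ∀ a ∈ ({0, 1} : Set ℝ),
      P ({ω | X ω ∈ D} ∩ {ω | A ω = a}) = P {ω | X ω ∈ D} * P {ω | A ω = a} := by
  intro D hD a ha
  exact T.measure_nodeDoms_inter P X {ω | A ω = a} α Set.univ (by simp)
    (fun DS hDS i hi => hCond DS hDS a ha i hi) D hD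
end
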